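/- Let n ≥ 1, let Ω ⊆ ℂⁿ be a bounded simply connected complete Reinhardt domain, H a nonzero complex Hilbert space, λ > 1 and 1 ≤ p < ∞. Then, for U the identity operator on B(H), L_λ(Ω,p,U) ≥ (1/2^{2+1/p}) · (λ^p − 1)^{1/p}/λ² · n^{−1/p} / (S(Ω,𝔻ⁿ)·S(𝔻ⁿ,Ω)). -/

import Mathlib

open scoped ENNReal Pointwise
open Filter

noncomputable section

namespace BohrPaper

/-- The monomial `z^α = z₁^{α₁} ⋯ z_n^{α_n}`. -/
def mpow {n : ℕ} (z : Fin n → ℂ) (α : Fin n → ℕ) : ℂ := ∏ j, z j ^ α j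

/-- A complete Reinhardt domain in `ℂⁿ`: nonempty, open, connected and closed under
componentwise decrease of moduli. -/
def IsCompleteReinhardt {n : ℕ} (Ω : Set (Fin n → ℂ)) : Prop :=
  IsOpen Ω ∧ IsConnected Ω ∧
    ∀ z ∈ Ω, ∀ w : Fin n → ℂ, (∀ j, ‖w j‖ ≤ ‖z j‖) → w ∈ Ω

/-- `S(Ω₁, Ω₂) := inf {s > 0 : Ω₁ ⊆ s·Ω₂}`. -/
def SRatio {n : ℕ} (Ω₁ Ω₂ : Set (Fin n → ℂ)) : ℝ :=
  sInf {s : ℝ | 0 < s ∧ Ω₁ ⊆ s • Ω₂}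

/-- The open unit polydisc `𝔻ⁿ`. -/
def polydisc (n : ℕ) : Set (Fin n → ℂ) := {z | ∀ j, ‖z j‖ < 1}

/-- The sup-norm of `f` over `Ω`. -/
def supNorm {n : ℕ} {E : Type*} [Norm E] (Ω : Set (Fin n → ℂ)) (f : (Fin n → ℂ) → E) : ℝ :=
  ⨆ z ∈ Ω, ‖f z‖

/-- The `ℓ_q`-norm on `ℂⁿ` (`q = ∞` gives the max norm). -/
def lqNorm (n : ℕ) (q : ℝ≥0∞) (z : Fin n → ℂ) : ℝ :=
  if q = ∞ then ⨆ j, ‖z j‖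
  else (∑ j, ‖z j‖ ^ q.toReal) ^ (1 / q.toReal)

/-- The open unit ball of `ℓⁿ_q`. -/
def lqBall (n : ℕ) (q : ℝ≥0∞) : Set (Fin n → ℂ) := {z | lqNorm n q z < 1}

/-- `N` is a norm on `ℂⁿ`. -/
def IsNorm {n : ℕ} (N : (Fin n → ℂ) → ℝ) : Prop :=
  (∀ z, 0 ≤ N z) ∧ (∀ z, N z = 0 → z = 0) ∧
    (∀ (c : ℂ) (z), N (c • z) = ‖c‖ * N z) ∧ ∀ z w, N (z + w) ≤ N z + N w

/-- The canonical basis of `ℂⁿ` is normalized and 1-unconditional for the norm `N`. -/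
def IsNormalized1Unconditional {n : ℕ} (N : (Fin n → ℂ) → ℝ) : Prop :=
  (∀ k, N (fun j => if j = k then 1 else 0) = 1) ∧
    ∀ ε μ : Fin n → ℂ, (∀ j, ‖ε j‖ ≤ 1) → N (fun j => ε j * μ j) ≤ N μ

/-- Open unit ball of the norm `N`. -/
def unitBall {n : ℕ} (N : (Fin n → ℂ) → ℝ) : Set (Fin n → ℂ) := {z | N z < 1}

/-- Operator norm of the identity map `(ℂⁿ, N₁) → (ℂⁿ, N₂)`. -/
def idNorm {n : ℕ} (N₁ N₂ : (Fin n → ℂ) → ℝ) : ℝ :=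
  sInf {c : ℝ | 0 ≤ c ∧ ∀ z, N₂ z ≤ c * N₁ z}

/-- `b_m(Ω) = (inf_{|α| = m} sup_{z ∈ Ω} |z^α|)^{-1/m}`. -/
def bCoef {n : ℕ} (Ω : Set (Fin n → ℂ)) (m : ℕ) : ℝ :=
  (sInf ((fun α : Fin n → ℕ => ⨆ z ∈ Ω, ‖mpow z α‖) ''
      {α : Fin n → ℕ | ∑ j, α j = m})) ^ (-(1 / (m : ℝ)))

section Pluriharmonic

variable {n : ℕ} {H : Type*} [NormedAddCommGroup H] [InnerProductSpace ℂ H] [CompleteSpace H]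
  {Y : Type*} [NormedAddCommGroup Y] [NormedSpace ℂ Y]

/-- `f` is a bounded pluriharmonic `B(H)`-valued function on `Ω`, given by coefficient
families `a`, `b` (with `b 0 = 0`): `f = Σ a_α z^α + Σ (b_α)* z̄^α`, both power series
converging locally uniformly on `Ω`, and `f` bounded on `Ω`. -/
def IsBddPluriharmonic (Ω : Set (Fin n → ℂ)) (f : (Fin n → ℂ) → H →L[ℂ] H)
    (a b : (Fin n → ℕ) → H →L[ℂ] H) : Prop :=
  b 0 = 0 ∧
    (∃ h g : (Fin n → ℂ) → H →L[ℂ] H,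
      TendstoLocallyUniformlyOn
        (fun (s : Finset (Fin n → ℕ)) z => ∑ α ∈ s, mpow z α • a α) h atTop Ω ∧
      TendstoLocallyUniformlyOn
        (fun (s : Finset (Fin n → ℕ)) z =>
          ∑ α ∈ s, mpow (star z) α • ContinuousLinearMap.adjoint (b α)) g atTop Ω ∧
      ∀ z ∈ Ω, f z = h z + g z) ∧
    BddAbove ((fun z => ‖f z‖) '' Ω)

/-- The left-hand side `Σ_α sup_{z ∈ rΩ} (‖U a_α‖^p + ‖U b_α‖^p)|z^α|^p` of the second
Bohr inequality for pluriharmonic functions, valued in `ℝ≥0∞`. -/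
def phBohrSum (Ω : Set (Fin n → ℂ)) (r p : ℝ) (U : (H →L[ℂ] H) →L[ℂ] Y)
    (a b : (Fin n → ℕ) → H →L[ℂ] H) : ℝ≥0∞ :=
  ∑' α : Fin n → ℕ, ⨆ z ∈ r • Ω,
    ENNReal.ofReal ((‖U (a α)‖ ^ p + ‖U (b α)‖ ^ p) * ‖mpow z α‖ ^ p)

/-- The second `λ`-powered Bohr radius `L_λ(Ω, p, U)` for pluriharmonic functions. -/
def secondBohrPH (Ω : Set (Fin n → ℂ)) (p lam : ℝ) (U : (H →L[ℂ] H) →L[ℂ] Y) : ℝ :=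
  sSup {r : ℝ | r ∈ Set.Icc (0 : ℝ) 1 ∧
    ∀ (f : (Fin n → ℂ) → H →L[ℂ] H) (a b : (Fin n → ℕ) → H →L[ℂ] H),
      IsBddPluriharmonic Ω f a b →
      phBohrSum Ω r p U a b ≤ ENNReal.ofReal (lam ^ p * supNorm Ω f ^ p)}

end Pluriharmonic

section Averaging

open MeasureTheory

variable {d : Type*} [Fintype d]

theorem integral_mFourier (k : d → ℤ) :
    ∫ t, UnitAddTorus.mFourier k t ∂(Measure.pi fun _ : d => AddCircle.haarAddCircle (T := 1)) =
      if k = 0 then 1 else 0 := by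
  have h1 : ∀ m : ℤ, ∫ t, fourier m t ∂(AddCircle.haarAddCircle (T := 1)) =
      if m = 0 then 1 else 0 := by
    intro m
    have := congrFun (fourierCoeff_fourier (T := 1) m) 0
    simp only [fourierCoeff, neg_zero, fourier_zero, one_smul] at this
    rw [this, Pi.single_apply]
    simp only [eq_comm]
  have h2 := integral_fintype_prod_eq_prod (𝕜 := ℂ)
    (μ := fun _ : d => AddCircle.haarAddCircle (T := 1)) (fun i t => fourier (k i) t)
  refine h2.trans ?_
  simp only [h1]
  split_ifs with h
  · simp [h]
  · obtain ⟨i, hi⟩ := Function.ne_iff.mp h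
    exact Finset.prod_eq_zero (Finset.mem_univ i) (by simpa using hi)

theorem norm_coeff_le_of_norm_mFourier_sum_le {ι E : Type*} [NormedAddCommGroup E]
    [NormedSpace ℂ E] [CompleteSpace E] (s : Finset ι) (k : ι → d → ℤ) (v : ι → E) {C : ℝ}
    (hC : ∀ t, ‖∑ i ∈ s, UnitAddTorus.mFourier (k i) t • v i‖ ≤ C) (m : d → ℤ) :
    ‖∑ i ∈ s, if k i = m then v i else 0‖ ≤ C := by
  set μ : Measure (d → UnitAddCircle) :=
    Measure.pi fun _ : d => AddCircle.haarAddCircle (T := 1)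
  have hmean : ∫ t, UnitAddTorus.mFourier (-m) t •
      ∑ i ∈ s, UnitAddTorus.mFourier (k i) t • v i ∂μ = ∑ i ∈ s, if k i = m then v i else 0 := by
    simp only [Finset.smul_sum, smul_smul, ← UnitAddTorus.mFourier_add]
    rw [integral_finsetSum]
    · refine Finset.sum_congr rfl fun i _ => ?_
      rw [integral_smul_const, integral_mFourier]
      simp only [neg_add_eq_zero, eq_comm (a := m)]
      split_ifs <;> simp
    · intro i _
      refine Integrable.smul_const ?_ _
      exact (UnitAddTorus.mFourier (-m + k i)).continuous.integrable_of_hasCompactSupport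
        (HasCompactSupport.of_compactSpace _)
  rw [← hmean]
  refine (norm_integral_le_of_norm_le_const (C := C) (.of_forall fun t => ?_)).trans ?_
  · rw [norm_smul]
    have h1 : ‖UnitAddTorus.mFourier (-m) t‖ ≤ 1 :=
      ((UnitAddTorus.mFourier (-m)).norm_coe_le_norm t).trans_eq UnitAddTorus.mFourier_norm
    exact (mul_le_of_le_one_left (norm_nonneg _) h1).trans (hC t)
  · simp

theorem norm_coeff_add_le_of_norm_mFourier_sum_le {ι E : Type*} [NormedAddCommGroup E]
    [NormedSpace ℂ E] [CompleteSpace E] (s : Finset ι) (k l : ι → d → ℤ) (v w : ι → E) {C : ℝ}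
    (hC : ∀ t, ‖∑ i ∈ s, UnitAddTorus.mFourier (k i) t • v i +
      ∑ i ∈ s, UnitAddTorus.mFourier (l i) t • w i‖ ≤ C) (m : d → ℤ) :
    ‖(∑ i ∈ s, if k i = m then v i else 0) + ∑ i ∈ s, if l i = m then w i else 0‖ ≤ C := by
  have := norm_coeff_le_of_norm_mFourier_sum_le (s.disjSum s) (Sum.elim k l) (Sum.elim v w)
    (C := C) (fun t => by rw [Finset.sum_disjSum]; exact hC t) m
  rw [Finset.sum_disjSum] at this
  exact this

end Averaging

section Torus

variable {n : ℕ}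

theorem mpow_mul_fourier (ρ : ℝ) (t : Fin n → UnitAddCircle) (α : Fin n → ℕ) :
    mpow (fun j => (ρ : ℂ) * fourier 1 (t j)) α =
      (ρ : ℂ) ^ (∑ j, α j) * UnitAddTorus.mFourier (fun j => (α j : ℤ)) t := by
  simp only [mpow, mul_pow, Finset.prod_mul_distrib, Finset.prod_pow_eq_pow_sum,
    UnitAddTorus.mFourier, ContinuousMap.coe_mk]
  congr 1
  refine Finset.prod_congr rfl fun j _ => ?_
  simp [fourier_apply, AddCircle.toCircle_nsmul]

theorem mpow_star (z : Fin n → ℂ) (α : Fin n → ℕ) : mpow (star z) α = star (mpow z α) := by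
  simp [mpow]

theorem norm_mpow_le {z : Fin n → ℂ} {R : ℝ} (hz : ∀ j, ‖z j‖ ≤ R) (α : Fin n → ℕ) :
    ‖mpow z α‖ ≤ R ^ (∑ j, α j) := by
  rw [mpow, norm_prod, ← Finset.prod_pow_eq_pow_sum]
  refine Finset.prod_le_prod (fun _ _ => norm_nonneg _) fun j _ => ?_
  rw [norm_pow]
  exact pow_le_pow_left₀ (norm_nonneg _) (hz j) _

end Torus

section Coefficients

variable {n : ℕ} {H : Type*} [NormedAddCommGroup H] [InnerProductSpace ℂ H] [CompleteSpace H]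
  {Ω : Set (Fin n → ℂ)} {f : (Fin n → ℂ) → H →L[ℂ] H} {a b : (Fin n → ℕ) → H →L[ℂ] H}

theorem IsBddPluriharmonic.norm_coeff_le (hf : IsBddPluriharmonic Ω f a b) {ρ M : ℝ}
    (hρ : 0 ≤ ρ) (hsub : ∀ z : Fin n → ℂ, (∀ j, ‖z j‖ = ρ) → z ∈ Ω)
    (hM : ∀ z ∈ Ω, ‖f z‖ ≤ M) (α : Fin n → ℕ) :
    ρ ^ (∑ j, α j) * ‖a α‖ ≤ M ∧ ρ ^ (∑ j, α j) * ‖b α‖ ≤ M := by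
  classical
  obtain ⟨hb0, ⟨h, g, hh, hg, hfg⟩, -⟩ := hf
  set K : Set (Fin n → ℂ) := {z | ∀ j, ‖z j‖ = ρ} with hK
  have hKc : IsCompact K := by
    have : K = Set.univ.pi fun _ => Metric.sphere (0 : ℂ) ρ := by
      ext z; simp [hK]
    rw [this]
    exact isCompact_univ_pi fun _ => isCompact_sphere _ _
  have hh' := (tendstoLocallyUniformlyOn_iff_tendstoUniformlyOn_of_compact hKc).1 (hh.mono hsub)
  have hg' := (tendstoLocallyUniformlyOn_iff_tendstoUniformlyOn_of_compact hKc).1 (hg.mono hsub)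
  have key : ∀ ε > 0, ρ ^ (∑ j, α j) * ‖a α‖ ≤ M + ε ∧ ρ ^ (∑ j, α j) * ‖b α‖ ≤ M + ε := by
    intro ε hε
    obtain ⟨s, hs⟩ := (((Metric.tendstoUniformlyOn_iff.1 hh' (ε / 2) (half_pos hε)).and
      (Metric.tendstoUniformlyOn_iff.1 hg' (ε / 2) (half_pos hε))).and
      (eventually_ge_atTop {α})).exists
    obtain ⟨⟨hs1, hs2⟩, hαs⟩ := hs
    have hαs : α ∈ s := Finset.singleton_subset_iff.1 hαs
    have hbound : ∀ t : UnitAddTorus (Fin n),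
        ‖∑ β ∈ s, UnitAddTorus.mFourier (fun j => (β j : ℤ)) t • (ρ : ℂ) ^ (∑ j, β j) • a β +
          ∑ β ∈ s, UnitAddTorus.mFourier (fun j => -(β j : ℤ)) t •
            (ρ : ℂ) ^ (∑ j, β j) • ContinuousLinearMap.adjoint (b β)‖ ≤ M + ε := by
      intro t
      set z : Fin n → ℂ := fun j => (ρ : ℂ) * fourier 1 (t j) with hz
      have hzK : z ∈ K := by
        intro j
        simp [hz, abs_of_nonneg hρ, fourier_apply, Circle.norm_coe]
      have e1 : ∀ β : Fin n → ℕ, mpow z β • a β =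
          UnitAddTorus.mFourier (fun j => (β j : ℤ)) t • (ρ : ℂ) ^ (∑ j, β j) • a β := by
        intro β
        rw [hz, mpow_mul_fourier, smul_smul, mul_comm]
      have e2 : ∀ β : Fin n → ℕ, mpow (star z) β • ContinuousLinearMap.adjoint (b β) =
          UnitAddTorus.mFourier (fun j => -(β j : ℤ)) t •
            (ρ : ℂ) ^ (∑ j, β j) • ContinuousLinearMap.adjoint (b β) := by
        intro β
        have : UnitAddTorus.mFourier (fun j => -(β j : ℤ)) t =
          star (UnitAddTorus.mFourier (fun j => (β j : ℤ)) t) := UnitAddTorus.mFourier_neg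
        rw [mpow_star, hz, mpow_mul_fourier, smul_smul, this, mul_comm, star_mul']
        simp
      simp only [← e1, ← e2]
      have h1 := hs1 z hzK
      have h2 := hs2 z hzK
      rw [dist_comm, dist_eq_norm] at h1 h2
      have h3 := hM z (hsub z hzK)
      rw [hfg z (hsub z hzK)] at h3
      calc _ = ‖(h z + g z) + ((∑ α ∈ s, mpow z α • a α) - h z) +
              ((∑ α ∈ s, mpow (star z) α • ContinuousLinearMap.adjoint (b α)) - g z)‖ := by
            congr 1; abel
        _ ≤ M + ε / 2 + ε / 2 :=
            (norm_add₃_le).trans (add_le_add (add_le_add h3 h1.le) h2.le)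
        _ = M + ε := by ring
    have hmean := norm_coeff_add_le_of_norm_mFourier_sum_le _ _ _ _ _ hbound
    have hfilter : ∀ (c : (Fin n → ℕ) → H →L[ℂ] H),
        (∑ β ∈ s, if β = α then c β else 0) = c α := fun c => by simp [hαs]
    have hρn : ‖(ρ : ℂ) ^ (∑ j, α j)‖ = ρ ^ (∑ j, α j) := by simp [abs_of_nonneg hρ]
    have hinj : ∀ β : Fin n → ℕ, ((fun j => (β j : ℤ)) = fun j => (α j : ℤ)) ↔ β = α := by
      intro β; simp [funext_iff]
    have hmix : ∀ β : Fin n → ℕ, ((fun j => -(β j : ℤ)) = fun j => (α j : ℤ)) →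
        β = 0 ∧ α = 0 := by
      intro β h
      constructor <;> funext j <;> have := congrFun h j <;> simp at this ⊢ <;> omega
    constructor
    · have h0 : (∑ β ∈ s, if (fun j => -(β j : ℤ)) = fun j => (α j : ℤ) then
          (ρ : ℂ) ^ (∑ j, β j) • ContinuousLinearMap.adjoint (b β) else 0) = 0 := by
        refine Finset.sum_eq_zero fun β _ => ?_
        split_ifs with h
        · simp [(hmix β h).1, hb0]
        · rfl
      have := hmean fun j => (α j : ℤ)
      rwa [h0, add_zero, Finset.sum_congr rfl fun β _ => if_congr (hinj β) rfl rfl, hfilter,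
        norm_smul, hρn] at this
    · by_cases hα : α = 0
      · have h0 : 0 ≤ M + ε := (norm_nonneg _).trans (hbound 0)
        simpa [hα, hb0] using h0
      have h0 : (∑ β ∈ s, if (fun j => (β j : ℤ)) = fun j => -(α j : ℤ) then
          (ρ : ℂ) ^ (∑ j, β j) • a β else 0) = 0 := by
        refine Finset.sum_eq_zero fun β _ => if_neg fun h => hα (hmix β ?_).2
        funext j
        have := congrFun h j
        omega
      have hinj' : ∀ β : Fin n → ℕ, ((fun j => -(β j : ℤ)) = fun j => -(α j : ℤ)) ↔ β = α := by
        intro β; simp [funext_iff]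
      have := hmean fun j => -(α j : ℤ)
      rwa [h0, zero_add, Finset.sum_congr rfl fun β _ => if_congr (hinj' β) rfl rfl, hfilter,
        norm_smul, hρn, LinearIsometryEquiv.norm_map] at this
  exact ⟨le_of_forall_pos_le_add fun ε hε => (key ε hε).1,
    le_of_forall_pos_le_add fun ε hε => (key ε hε).2⟩

end Coefficients

theorem tsum_pow_sum_eq (n : ℕ) (y : ℝ≥0∞) :
    ∑' α : Fin n → ℕ, y ^ (∑ j, α j) = ((1 - y)⁻¹) ^ n := by
  induction n with
  | zero => simp
  | succ n ih =>
    rw [← (Fin.consEquiv fun _ : Fin (n + 1) => ℕ).tsum_eq, ENNReal.tsum_prod']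
    simp only [Fin.consEquiv_apply, Fin.sum_univ_succ, Fin.cons_zero, Fin.cons_succ, pow_add,
      ENNReal.tsum_mul_left, ih, ENNReal.tsum_mul_right, ENNReal.tsum_geometric]
    rw [pow_one, mul_comm]

section Ratio

variable {n : ℕ} {Ω : Set (Fin n → ℂ)}

theorem SRatio_nonneg (Ω₁ Ω₂ : Set (Fin n → ℂ)) : 0 ≤ SRatio Ω₁ Ω₂ :=
  Real.sInf_nonneg fun _ hs => hs.1.le

theorem mem_smul_polydisc {s : ℝ} (hs : 0 < s) {z : Fin n → ℂ} :
    z ∈ s • polydisc n ↔ ∀ j, ‖z j‖ < s := by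
  rw [Set.mem_smul_set_iff_inv_smul_mem₀ hs.ne']
  simp only [polydisc, Set.mem_ofPred_eq, Pi.smul_apply, norm_smul, norm_inv, Real.norm_eq_abs,
    abs_of_pos hs, inv_mul_lt_one₀ hs]

theorem ratio_set_nonempty (hb : Bornology.IsBounded Ω) :
    {s : ℝ | 0 < s ∧ Ω ⊆ s • polydisc n}.Nonempty := by
  obtain ⟨R, hR0, hR⟩ := hb.exists_pos_norm_lt
  exact ⟨R, hR0, fun z hz => (mem_smul_polydisc hR0).2 fun j =>
    (norm_le_pi_norm z j).trans_lt (hR z hz)⟩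

theorem IsCompleteReinhardt.ratio_set_nonempty (hR : IsCompleteReinhardt Ω) :
    {s : ℝ | 0 < s ∧ polydisc n ⊆ s • Ω}.Nonempty := by
  obtain ⟨hO, hC, hR⟩ := hR
  obtain ⟨w, hw⟩ := hC.nonempty
  obtain ⟨ε, hε, hball⟩ := Metric.isOpen_iff.1 hO 0 (hR w hw 0 (by simp))
  refine ⟨ε⁻¹, inv_pos.2 hε, fun z hz => ?_⟩
  rw [Set.mem_smul_set_iff_inv_smul_mem₀ (inv_pos.2 hε).ne', inv_inv]
  refine hball ?_
  rw [mem_ball_zero_iff, pi_norm_lt_iff hε]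
  intro j
  rw [Pi.smul_apply, norm_smul, Real.norm_eq_abs, abs_of_pos hε]
  exact mul_lt_of_lt_one_right hε (hz j)

theorem norm_le_SRatio (hb : Bornology.IsBounded Ω) {z : Fin n → ℂ} (hz : z ∈ Ω) (j : Fin n) :
    ‖z j‖ ≤ SRatio Ω (polydisc n) :=
  le_csInf (ratio_set_nonempty hb) fun _ hs => ((mem_smul_polydisc hs.1).1 (hs.2 hz) j).le

theorem IsCompleteReinhardt.mem_of_lt (hR : IsCompleteReinhardt Ω) {s : ℝ}
    (hs : SRatio (polydisc n) Ω < s) {z : Fin n → ℂ} (hz : ∀ j, ‖z j‖ ≤ s⁻¹) : z ∈ Ω := by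
  obtain ⟨s', ⟨h0, hsub⟩, hlt⟩ := exists_lt_of_csInf_lt hR.ratio_set_nonempty hs
  rw [← Set.smul_mem_smul_set_iff₀ h0.ne']
  refine hsub fun j => ?_
  rw [Pi.smul_apply, norm_smul, Real.norm_eq_abs, abs_of_pos h0]
  calc s' * ‖z j‖ ≤ s' * s⁻¹ := by gcongr; exact hz j
    _ < 1 := by rw [mul_inv_lt_iff₀ (h0.trans hlt), one_mul]; exact hlt

theorem one_le_SRatio_mul_SRatio (hn : 1 ≤ n) (hR : IsCompleteReinhardt Ω)
    (hb : Bornology.IsBounded Ω) : 1 ≤ SRatio Ω (polydisc n) * SRatio (polydisc n) Ω := by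
  have h : ∀ s, SRatio (polydisc n) Ω < s → 1 ≤ SRatio Ω (polydisc n) * s := by
    intro s hs
    have hs0 : 0 < s := (SRatio_nonneg _ _).trans_lt hs
    have hmem : (fun _ => ((s⁻¹ : ℝ) : ℂ)) ∈ Ω :=
      hR.mem_of_lt hs fun j => by rw [Complex.norm_real, Real.norm_of_nonneg (inv_pos.2 hs0).le]
    have := norm_le_SRatio hb hmem ⟨0, hn⟩
    rw [Complex.norm_real, Real.norm_of_nonneg (inv_pos.2 hs0).le] at this
    rwa [inv_le_iff_one_le_mul₀ hs0] at this
  have hlim : Tendsto (fun s => SRatio Ω (polydisc n) * s)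
      (nhdsWithin (SRatio (polydisc n) Ω) (Set.Ioi (SRatio (polydisc n) Ω)))
      (nhds (SRatio Ω (polydisc n) * SRatio (polydisc n) Ω)) :=
    (continuous_const.mul continuous_id).continuousWithinAt
  exact ge_of_tendsto hlim (eventually_mem_nhdsWithin.mono fun s hs => h s hs)

end Ratio

theorem supNorm_nonneg {n : ℕ} {E : Type*} [SeminormedAddCommGroup E] (Ω : Set (Fin n → ℂ))
    (f : (Fin n → ℂ) → E) : 0 ≤ supNorm Ω f :=
  Real.iSup_nonneg fun _ => Real.iSup_nonneg fun _ => norm_nonneg _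

section Bound

variable {n : ℕ} {H : Type*} [NormedAddCommGroup H] [InnerProductSpace ℂ H] [CompleteSpace H]
  {Ω : Set (Fin n → ℂ)} {f : (Fin n → ℂ) → H →L[ℂ] H} {a b : (Fin n → ℕ) → H →L[ℂ] H}

theorem IsBddPluriharmonic.norm_le_supNorm (hf : IsBddPluriharmonic Ω f a b) {z : Fin n → ℂ}
    (hz : z ∈ Ω) : ‖f z‖ ≤ supNorm Ω f := by
  obtain ⟨C, hC⟩ := hf.2.2
  have hC' : ∀ w ∈ Ω, ‖f w‖ ≤ C := fun w hw => hC ⟨w, hw, rfl⟩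
  have hC0 : 0 ≤ C := (norm_nonneg _).trans (hC' z hz)
  have h1 : BddAbove (Set.range fun w => ⨆ _ : w ∈ Ω, ‖f w‖) :=
    ⟨C, by rintro _ ⟨w, rfl⟩; exact Real.iSup_le (hC' w) hC0⟩
  refine le_trans ?_ (le_ciSup h1 z)
  simp [hz]

theorem IsBddPluriharmonic.norm_coeff_le_SRatio (hf : IsBddPluriharmonic Ω f a b)
    (hR : IsCompleteReinhardt Ω) (α : Fin n → ℕ) :
    ‖a α‖ ≤ supNorm Ω f * SRatio (polydisc n) Ω ^ (∑ j, α j) ∧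
      ‖b α‖ ≤ supNorm Ω f * SRatio (polydisc n) Ω ^ (∑ j, α j) := by
  have h : ∀ s, SRatio (polydisc n) Ω < s → ‖a α‖ ≤ supNorm Ω f * s ^ (∑ j, α j) ∧
      ‖b α‖ ≤ supNorm Ω f * s ^ (∑ j, α j) := by
    intro s hs
    have hs0 : 0 < s := (SRatio_nonneg _ _).trans_lt hs
    have := hf.norm_coeff_le (inv_pos.2 hs0).le
      (fun z hz => hR.mem_of_lt hs fun j => (hz j).le) (fun z hz => hf.norm_le_supNorm hz) α
    rwa [inv_pow, inv_mul_le_iff₀' (pow_pos hs0 _), inv_mul_le_iff₀' (pow_pos hs0 _)] at this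
  have hlim : Tendsto (fun s => supNorm Ω f * s ^ (∑ j, α j))
      (nhdsWithin (SRatio (polydisc n) Ω) (Set.Ioi (SRatio (polydisc n) Ω)))
      (nhds (supNorm Ω f * SRatio (polydisc n) Ω ^ (∑ j, α j))) :=
    (continuous_const.mul (continuous_id.pow _)).continuousWithinAt
  exact ⟨ge_of_tendsto hlim (eventually_mem_nhdsWithin.mono fun s hs => (h s hs).1),
    ge_of_tendsto hlim (eventually_mem_nhdsWithin.mono fun s hs => (h s hs).2)⟩

theorem IsBddPluriharmonic.phBohrSum_id_le (hf : IsBddPluriharmonic Ω f a b)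
    (hR : IsCompleteReinhardt Ω) (hb : Bornology.IsBounded Ω) {r p L : ℝ} (hr : 0 ≤ r)
    (hp : 0 < p)
    (hL : ((1 - ENNReal.ofReal ((r * (SRatio Ω (polydisc n) * SRatio (polydisc n) Ω)) ^ p))⁻¹) ^ n
      ≤ ENNReal.ofReal ((L + 1) / 2)) (hL0 : 0 ≤ L) :
    phBohrSum Ω r p (ContinuousLinearMap.id ℂ (H →L[ℂ] H)) a b ≤
      ENNReal.ofReal (L * supNorm Ω f ^ p) := by
  set M := supNorm Ω f with hM
  set S₁ := SRatio Ω (polydisc n) with hS₁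
  set S₂ := SRatio (polydisc n) Ω with hS₂
  have hM0 : 0 ≤ M := supNorm_nonneg Ω f
  have hS₁0 : 0 ≤ S₁ := SRatio_nonneg _ _
  have hS₂0 : 0 ≤ S₂ := SRatio_nonneg _ _
  have hMp : 0 ≤ M ^ p := Real.rpow_nonneg hM0 p
  set x := r * (S₁ * S₂) with hx
  have hx0 : 0 ≤ x := by positivity
  have hterm : ∀ (c : H →L[ℂ] H) (α : Fin n → ℕ), ‖c‖ ≤ M * S₂ ^ (∑ j, α j) →
      ∀ z ∈ r • Ω, ‖c‖ ^ p * ‖mpow z α‖ ^ p ≤ M ^ p * (x ^ p) ^ (∑ j, α j) := by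
    rintro c α hc _ ⟨w, hw, rfl⟩
    have h1 : ‖mpow (r • w) α‖ ≤ (r * S₁) ^ (∑ j, α j) := by
      refine norm_mpow_le (fun j => ?_) α
      rw [Pi.smul_apply, norm_smul, Real.norm_of_nonneg hr]
      exact mul_le_mul_of_nonneg_left (norm_le_SRatio hb hw j) hr
    have h2 : ‖c‖ * ‖mpow (r • w) α‖ ≤ M * x ^ (∑ j, α j) := by
      refine (mul_le_mul hc h1 (norm_nonneg _) (by positivity)).trans_eq ?_
      rw [mul_assoc, ← mul_pow, hx]
      ring_nf
    rw [← Real.mul_rpow (norm_nonneg _) (norm_nonneg _), Real.rpow_pow_comm hx0,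
      ← Real.mul_rpow hM0 (by positivity)]
    exact Real.rpow_le_rpow (by positivity) h2 hp.le
  have hsum : ∀ α : Fin n → ℕ,
      (⨆ z ∈ r • Ω, ENNReal.ofReal ((‖ContinuousLinearMap.id ℂ (H →L[ℂ] H) (a α)‖ ^ p +
        ‖ContinuousLinearMap.id ℂ (H →L[ℂ] H) (b α)‖ ^ p) * ‖mpow z α‖ ^ p)) +
        (if α = 0 then ENNReal.ofReal (M ^ p) else 0) ≤
      ENNReal.ofReal (2 * M ^ p) * ENNReal.ofReal (x ^ p) ^ (∑ j, α j) := by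
    intro α
    obtain ⟨ha, hb'⟩ := hf.norm_coeff_le_SRatio hR α
    rw [← ENNReal.ofReal_pow (by positivity), ← ENNReal.ofReal_mul (by positivity)]
    by_cases hα : α = 0
    · have e : ENNReal.ofReal (2 * M ^ p * (x ^ p) ^ (∑ j, α j)) =
          ENNReal.ofReal (M ^ p) + ENNReal.ofReal (M ^ p) := by
        rw [← ENNReal.ofReal_add hMp hMp]; simp [hα, two_mul]
      rw [if_pos hα, e]
      gcongr
      refine iSup₂_le fun z hz => ENNReal.ofReal_le_ofReal ?_
      have := hterm _ α ha z hz
      subst hα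
      simpa [hf.1, Real.zero_rpow hp.ne'] using this
    · rw [if_neg hα, add_zero]
      refine iSup₂_le fun z hz => ENNReal.ofReal_le_ofReal ?_
      have h1 := hterm _ α ha z hz
      have h2 := hterm _ α hb' z hz
      simp only [ContinuousLinearMap.id_apply]
      linarith
  have htot := ENNReal.tsum_le_tsum hsum
  rw [ENNReal.tsum_add, tsum_ite_eq, ENNReal.tsum_mul_left, tsum_pow_sum_eq] at htot
  refine (ENNReal.add_le_add_iff_right (ENNReal.ofReal_ne_top (r := M ^ p))).1 (htot.trans ?_)
  refine (mul_le_mul_right hL _).trans_eq ?_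
  rw [← ENNReal.ofReal_mul (by positivity), ← ENNReal.ofReal_add (by positivity) hMp]
  congr 1
  ring

end Bound

theorem inv_one_sub_pow_le {n : ℕ} (hn : 1 ≤ n) {y L : ℝ} (hy : 0 ≤ y) (hL : 1 < L)
    (hyL : n * y ≤ (L - 1) / (L + 1)) :
    ((1 - ENNReal.ofReal y)⁻¹) ^ n ≤ ENNReal.ofReal ((L + 1) / 2) := by
  have hn' : (1 : ℝ) ≤ n := by exact_mod_cast hn
  have hlt : (L - 1) / (L + 1) < 1 := by rw [div_lt_one (by linarith)]; linarith
  have hy1 : y < 1 := by nlinarith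
  have hbern : 1 - (n : ℝ) * y ≤ (1 - y) ^ n := by
    have := one_add_mul_le_pow (a := -y) (by linarith) n
    simpa [sub_eq_add_neg] using this
  have h2 : 2 / (L + 1) ≤ (1 - y) ^ n := by
    have : 2 / (L + 1) = 1 - (L - 1) / (L + 1) := by field_simp; ring
    linarith
  rw [← ENNReal.ofReal_one, ← ENNReal.ofReal_sub _ hy, ← ENNReal.ofReal_inv_of_pos (by linarith),
    ← ENNReal.ofReal_pow (inv_nonneg.2 (by linarith)), inv_pow]
  refine ENNReal.ofReal_le_ofReal ?_
  calc ((1 - y) ^ n)⁻¹ ≤ (2 / (L + 1))⁻¹ := inv_anti₀ (by positivity) h2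
    _ = (L + 1) / 2 := inv_div _ _

theorem bohr_constant_rpow {n : ℕ} {p lam : ℝ} (hp : 1 ≤ p) (hlam : 1 < lam) :
    ((1 / (2 : ℝ) ^ (2 + 1 / p)) * ((lam ^ p - 1) ^ (1 / p) / lam ^ (2 : ℕ)) *
        (n : ℝ) ^ (-(1 / p))) ^ p =
      1 / (2 : ℝ) ^ (2 * p + 1) * ((lam ^ p - 1) / (lam ^ p) ^ 2) * (n : ℝ)⁻¹ := by
  have hp0 : p ≠ 0 := by linarith
  have hl0 : 0 < lam := by linarith
  have hL : 0 ≤ lam ^ p - 1 := by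
    have := Real.one_le_rpow hlam.le (by linarith : 0 ≤ p)
    linarith
  rw [Real.mul_rpow (by positivity) (by positivity), Real.mul_rpow (by positivity) (by positivity),
    Real.div_rpow (by positivity) (by positivity), Real.div_rpow (by positivity) (by positivity),
    Real.one_rpow, ← Real.rpow_mul (by positivity), ← Real.rpow_mul hL,
    ← Real.rpow_mul (by positivity), Real.rpow_pow_comm hl0.le,
    one_div_mul_cancel hp0, Real.rpow_one, neg_mul, one_div_mul_cancel hp0,
    Real.rpow_neg_one]
  congr 4
  field_simp

/-- lower bound for the second Bohr radius of pluriharmonic functions for the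
identity operator on `B(H)`. -/
theorem second_bohr_PH_lower_bound_id {n : ℕ} (hn : 1 ≤ n) (Ω : Set (Fin n → ℂ))
    (hR : IsCompleteReinhardt Ω) (hb : Bornology.IsBounded Ω)
    (hs : SimplyConnectedSpace Ω)
    {H : Type*} [NormedAddCommGroup H] [InnerProductSpace ℂ H] [CompleteSpace H]
    [Nontrivial H]
    (p lam : ℝ) (hp : 1 ≤ p) (hlam : 1 < lam) :
    (1 / (2 : ℝ) ^ (2 + 1 / p)) * ((lam ^ p - 1) ^ (1 / p) / lam ^ (2 : ℕ)) *
        (n : ℝ) ^ (-(1 / p)) / (SRatio Ω (polydisc n) * SRatio (polydisc n) Ω) ≤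
      secondBohrPH Ω p lam (ContinuousLinearMap.id ℂ (H →L[ℂ] H)) := by
  set S := SRatio Ω (polydisc n) * SRatio (polydisc n) Ω with hS
  set x := (1 / (2 : ℝ) ^ (2 + 1 / p)) * ((lam ^ p - 1) ^ (1 / p) / lam ^ (2 : ℕ)) *
    (n : ℝ) ^ (-(1 / p)) with hx
  have hS1 : 1 ≤ S := one_le_SRatio_mul_SRatio hn hR hb
  have hp0 : 0 < p := by linarith
  have hn' : (1 : ℝ) ≤ n := by exact_mod_cast hn
  have hL : 1 < lam ^ p := Real.one_lt_rpow hlam hp0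
  have hx0 : 0 ≤ x := by
    have : 0 ≤ lam ^ p - 1 := by linarith
    positivity
  have hxp : n * x ^ p ≤ (lam ^ p - 1) / (lam ^ p + 1) := by
    rw [hx, bohr_constant_rpow hp hlam]
    set L := lam ^ p
    have h8 : (1 : ℝ) ≤ (2 : ℝ) ^ (2 * p + 1) := Real.one_le_rpow (by norm_num) (by linarith)
    have h2 : (2 : ℝ) ≤ (2 : ℝ) ^ (2 * p + 1) := by
      simpa using Real.rpow_le_rpow_of_exponent_le (by norm_num : (1 : ℝ) ≤ 2)
        (by linarith : 1 ≤ 2 * p + 1)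
    calc (n : ℝ) * (1 / 2 ^ (2 * p + 1) * ((L - 1) / L ^ 2) * (n : ℝ)⁻¹)
        = (L - 1) / (2 ^ (2 * p + 1) * L ^ 2) := by field_simp
      _ ≤ (L - 1) / (L + 1) := by
        refine div_le_div_of_nonneg_left (by linarith) (by linarith) ?_
        nlinarith [sq_nonneg L]
  have hx1 : x ≤ 1 := by
    by_contra! h
    have h1 : 1 < x ^ p := Real.one_lt_rpow h hp0
    have h2 : (lam ^ p - 1) / (lam ^ p + 1) < 1 := by
      rw [div_lt_one (by linarith)]; linarith
    nlinarith
  refine le_csSup ⟨1, fun r hr => hr.1.2⟩ ⟨⟨by positivity, ?_⟩, fun f a b hf => ?_⟩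
  · exact (div_le_one (by linarith)).2 (hx1.trans hS1)
  · refine hf.phBohrSum_id_le hR hb (by positivity) hp0 ?_ (by linarith)
    rw [← hS, div_mul_cancel₀ _ (by linarith : S ≠ 0)]
    exact inv_one_sub_pow_le hn (Real.rpow_nonneg hx0 p) hL hxp

end BohrPaper
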